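/- arXiv:2309.04726 — 4 statements merged into one kernel-verified Lean document; each statement's English description precedes it below -/
import Mathlib

section
/- Let n ≥ 2 and let λ be a real number. Then the adjugate of the matrix (1 − λ)·I_n − J_n equals (1 − λ)^(n−2) · ( (1 − λ − n)·I_n + J_n ); that is, every diagonal entry of adj((1 − λ)I_n − J_n) equals (1 − λ)^(n−2)(2 − n − λ) = C_p(n−1)(λ) and every off-diagonal entry equals (1 − λ)^(n−2). -/
open Matrix in
theorem aux_det (n : ℕ) (hn : 2 ≤ n) (t : ℝ) (ht : t ≠ 0) :
    (t • (1 : Matrix (Fin n) (Fin n) ℝ) - Matrix.of (fun (_ _ : Fin n) => (1 : ℝ))).det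
      = t ^ (n - 2) * (t * (t - n)) := by
  have h : t • (1 : Matrix (Fin n) (Fin n) ℝ) - Matrix.of (fun (_ _ : Fin n) => (1 : ℝ))
      = t • (1 + replicateCol Unit (fun _ : Fin n => -t⁻¹) * replicateRow Unit (fun _ : Fin n => (1:ℝ))) := by
    ext i j
    simp [Matrix.mul_apply, mul_add, ht, sub_eq_add_neg]
  rw [h, det_smul, det_one_add_replicateCol_mul_replicateRow]
  obtain ⟨k, rfl⟩ := Nat.exists_eq_add_of_le hn
  simp [dotProduct]
  field_simp
  ring

theorem aux_mul (n : ℕ) (t : ℝ) :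
    (t • (1 : Matrix (Fin n) (Fin n) ℝ) - Matrix.of (fun (_ _ : Fin n) => (1 : ℝ)))
      * ((t - n) • (1 : Matrix (Fin n) (Fin n) ℝ) + Matrix.of (fun (_ _ : Fin n) => (1 : ℝ)))
      = (t * (t - n)) • (1 : Matrix (Fin n) (Fin n) ℝ) := by
  have hJ : Matrix.of (fun (_ _ : Fin n) => (1 : ℝ)) * Matrix.of (fun (_ _ : Fin n) => (1 : ℝ))
      = (n : ℝ) • Matrix.of (fun (_ _ : Fin n) => (1 : ℝ)) := by
    ext i j
    simp [Matrix.mul_apply]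
  simp only [sub_mul, mul_add, hJ, smul_mul_assoc, mul_smul_comm, one_mul, mul_one]
  module

theorem aux_generic (n : ℕ) (hn : 2 ≤ n) (t : ℝ) (ht : t ≠ 0) (htn : t ≠ n) :
    (t • (1 : Matrix (Fin n) (Fin n) ℝ) - Matrix.of (fun (_ _ : Fin n) => (1 : ℝ))).adjugate
      = t ^ (n - 2) • ((t - n) • (1 : Matrix (Fin n) (Fin n) ℝ)
            + Matrix.of (fun (_ _ : Fin n) => (1 : ℝ))) := by
  have hd := aux_det n hn t ht
  have hm := aux_mul n t
  generalize t • (1 : Matrix (Fin n) (Fin n) ℝ) - Matrix.of (fun (_ _ : Fin n) => (1 : ℝ)) = M at *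
  generalize (t - n) • (1 : Matrix (Fin n) (Fin n) ℝ)
    + Matrix.of (fun (_ _ : Fin n) => (1 : ℝ)) = N at *
  have hc : t * (t - n) ≠ 0 := mul_ne_zero ht (sub_ne_zero.2 htn)
  have h1 : M.adjugate * (M * N) = M.det • N := by
    rw [← mul_assoc, Matrix.adjugate_mul, smul_mul_assoc, one_mul]
  rw [hm, hd, mul_smul_comm, mul_one, mul_comm (t ^ (n - 2)), mul_smul _ (t ^ (n - 2))] at h1
  exact smul_right_injective _ hc h1

/-- The adjugate of `(1 − λ)I_n − J_n` equals
`(1 − λ)^(n−2) ((1 − λ − n)I_n + J_n)`. -/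
theorem adjugate_one_sub_lam_smul_id_sub_allOnes (n : ℕ) (hn : 2 ≤ n) (lam : ℝ) :
    ((1 - lam) • (1 : Matrix (Fin n) (Fin n) ℝ)
        - Matrix.of (fun (_ _ : Fin n) => (1 : ℝ))).adjugate
      = (1 - lam) ^ (n - 2) •
          ((1 - lam - n) • (1 : Matrix (Fin n) (Fin n) ℝ)
            + Matrix.of (fun (_ _ : Fin n) => (1 : ℝ))) := by
  have hs : Dense (({0, (n : ℝ)} : Set ℝ)ᶜ) :=
    (Set.toFinite ({0, (n : ℝ)} : Set ℝ)).countable.dense_compl ℝ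
  have key := Continuous.ext_on hs
    (f := fun t : ℝ => (t • (1 : Matrix (Fin n) (Fin n) ℝ)
        - Matrix.of (fun (_ _ : Fin n) => (1 : ℝ))).adjugate)
    (g := fun t : ℝ => t ^ (n - 2) • ((t - n) • (1 : Matrix (Fin n) (Fin n) ℝ)
            + Matrix.of (fun (_ _ : Fin n) => (1 : ℝ))))
    (Continuous.matrix_adjugate (by fun_prop)) (by fun_prop)
    (fun t ht => by
      simp only [Set.mem_compl_iff, Set.mem_insert_iff, Set.mem_singleton_iff, not_or] at ht
      exact aux_generic n hn t ht.1 ht.2)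
  exact congrFun key (1 - lam)
end

section
/- Let k ≥ 2 and p ≥ 1 be integers and let M be the (k−1)p × (k−1)p real matrix with k−1 diagonal blocks equal to −(J_p − I_p) and all off-diagonal blocks equal to J_p (this is the Seidel matrix of the signed complete graph on (k−1)p vertices whose negative edges induce k−1 disjoint copies of K_p). Then for every real λ, det(λ·I − M) = (λ − (p(k−3) + 1)) · (λ − (1 − 2p))^(k−2) · (λ − 1)^((k−1)(p−1)). -/
/-- Seidel matrix of the signed complete graph on `(k−1)p` vertices whose negative
edges induce `k−1` disjoint copies of `K_p`: diagonal blocks `−(J_p − I_p)`,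
off-diagonal blocks `J_p`. -/
def seidelDisjointCliques (k p : ℕ) :
    Matrix (Fin (k - 1) × Fin p) (Fin (k - 1) × Fin p) ℝ :=
  Matrix.of fun x y => if x = y then 0 else if x.1 = y.1 then -1 else 1

open Polynomial in
theorem det_smul_one_sub_aux {n : Type*} [Fintype n] [DecidableEq n]
    (A : Matrix n n ℝ) (c : ℝ) :
    (c • (1 : Matrix n n ℝ) - A).det = A.charpoly.eval c := by
  rw [Matrix.eval_charpoly, Matrix.smul_one_eq_diagonal]
  rfl

/-- Characteristic polynomial of the Seidel matrix of `k−1` disjoint `p`-cliques. -/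
theorem charpoly_seidelDisjointCliques (k p : ℕ) (hk : 2 ≤ k) (hp : 1 ≤ p) (lam : ℝ) :
    (lam • (1 : Matrix (Fin (k - 1) × Fin p) (Fin (k - 1) × Fin p) ℝ)
        - seidelDisjointCliques k p).det
      = (lam - ((p : ℝ) * ((k : ℝ) - 3) + 1)) * (lam - (1 - 2 * (p : ℝ))) ^ (k - 2)
          * (lam - 1) ^ ((k - 1) * (p - 1)) := by
  obtain ⟨n, rfl⟩ : ∃ n, k = n + 2 := ⟨k - 2, by omega⟩
  obtain ⟨q, rfl⟩ : ∃ q, p = q + 1 := ⟨p - 1, by omega⟩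
  let A : Matrix (Fin (n + 2 - 1) × Fin (q + 1)) (Fin (n + 2 - 1)) ℝ :=
    Matrix.of fun x j => if x.1 = j then -1 else 1
  let B : Matrix (Fin (n + 2 - 1)) (Fin (n + 2 - 1) × Fin (q + 1)) ℝ :=
    Matrix.of fun j x => if j = x.1 then 1 else 0
  have h1 : lam • (1 : Matrix (Fin (n + 2 - 1) × Fin (q + 1)) _ ℝ)
        - seidelDisjointCliques (n + 2) (q + 1) = (lam - 1) • 1 - A * B := by
    ext x y
    simp only [seidelDisjointCliques, A, B, Matrix.sub_apply, Matrix.smul_apply, Matrix.mul_apply,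
      Matrix.of_apply, Matrix.one_apply, smul_eq_mul, mul_ite, mul_one, mul_zero,
      Finset.sum_ite_eq', Finset.mem_univ, if_true]
    by_cases h : x = y
    · subst h; simp
    · simp [h]
  have h2 : B * A = Matrix.vecMulVec (fun _ => ((q + 1 : ℕ) : ℝ)) (fun _ => 1)
      - (2 * ((q + 1 : ℕ) : ℝ)) • 1 := by
    ext i j
    simp only [A, B, Matrix.sub_apply, Matrix.smul_apply, Matrix.mul_apply, Matrix.vecMulVec_apply,
      Matrix.of_apply, Matrix.one_apply, smul_eq_mul, Fintype.sum_prod_type]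
    rw [Finset.sum_eq_single i (fun b _ hb => by simp [Ne.symm hb]) (by simp)]
    by_cases h : i = j
    · subst h; simp; ring
    · simp [h]
  rw [h1, det_smul_one_sub_aux, Matrix.charpoly_mul_comm_of_le _ _ (by simp),
    Polynomial.eval_mul, ← det_smul_one_sub_aux, h2, sub_sub_eq_add_sub, ← add_smul,
    det_smul_one_sub_aux, Matrix.charpoly_vecMulVec]
  have e : (n + 1) * (q + 1) - (n + 1) = (n + 1) * q := by
    rw [mul_add, mul_one, Nat.add_sub_cancel]
  simp [e, pow_succ, dotProduct]
  ring
end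

section
/- Let k ≥ 2 and 1 ≤ p ≤ h with h ≥ 2 be integers, set n = (k−1)p + h, and let S be the n×n Seidel matrix of the signed complete graph on n vertices whose negative edges induce the union of k cliques of order h sharing a common clique of order h − p (each clique having p private vertices). Then for every real λ, det(S − λ·I_n) = (1 − 2p − λ)^(k−2) · (1 − λ)^(n−k−1) · s(λ), where s(λ) = −λ³ − (2h − n + 2p − 3)λ² − (2h² − 2(h−1)n + 2(h−2)p − 4h + 3)λ + 2h² − (2h−1)n − 2(2h² − 2hn − h + 1)p + 4(h − n)p² − 2h + 1. -/
/-- Seidel matrix of the signed complete graph on `n = (k−1)p + h` vertices whose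
negative edges induce the union of `k` cliques of order `h` sharing a common clique
of order `h − p` (each clique having `p` private vertices). -/
def seidelCliques (k p h : ℕ) :
    Matrix (Fin ((k - 1) * p) ⊕ Fin h) (Fin ((k - 1) * p) ⊕ Fin h) ℝ :=
  Matrix.of fun x y =>
    match x, y with
    | .inl i, .inl j =>
        if i = j then 0 else if (i : ℕ) / p = (j : ℕ) / p then -1 else 1
    | .inl _, .inr j => if (j : ℕ) < h - p then -1 else 1
    | .inr i, .inl _ => if (i : ℕ) < h - p then -1 else 1
    | .inr i, .inr j => if i = j then 0 else -1

open Matrix Polynomial in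
lemma det_smul_add_mul {m n : Type} [Fintype m] [DecidableEq m] [Fintype n] [DecidableEq n]
    (A : Matrix m n ℝ) (B : Matrix n m ℝ) (t : ℝ) (hle : Fintype.card n ≤ Fintype.card m) :
    (t • (1 : Matrix m m ℝ) + A * B).det
      = t ^ (Fintype.card m - Fintype.card n) * (t • (1 : Matrix n n ℝ) + B * A).det := by
  have h := congrArg (Polynomial.eval t) (Matrix.charpoly_mul_comm_of_le (-A) B hle)
  simp only [Polynomial.eval_mul, Polynomial.eval_pow, Polynomial.eval_X,
    Matrix.eval_charpoly] at h
  simpa [Matrix.smul_one_eq_diagonal, sub_neg_eq_add] using h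

/-- Sign between blocks; `none` is the common block. -/
def blockSign {κ : Type} [DecidableEq κ] : Option κ → Option κ → ℝ
  | none, _ => -1
  | some _, none => -1
  | some a, some b => if a = b then -1 else 1

lemma det_quotient {κ : Type} [Fintype κ] [DecidableEq κ] (hκ : 1 ≤ Fintype.card κ)
    (p c t : ℝ) (w : Option κ → ℝ) (hw0 : w none = c) (hw1 : ∀ a, w (some a) = p) :
    (t • (1 : Matrix (Option κ) (Option κ) ℝ)
      + Matrix.of (fun a b => blockSign a b * w b)).det
      = (t - 2 * p) ^ (Fintype.card κ - 1) *
        ((t - 2 * p + Fintype.card κ * p) * (t - c) - c * Fintype.card κ * p) := by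
  let U : Matrix (Option κ) Bool ℝ := Matrix.of fun a b => if a.isSome = b then 1 else 0
  let V : Matrix Bool (Option κ) ℝ := Matrix.of fun b a =>
    match b, a with
    | true, some _ => p
    | true, none => -c
    | false, some _ => -p
    | false, none => 2 * p - c
  have h1 : t • (1 : Matrix (Option κ) (Option κ) ℝ)
      + Matrix.of (fun a b => blockSign a b * w b)
      = (t - 2 * p) • (1 : Matrix (Option κ) (Option κ) ℝ) + U * V := by
    ext a b
    rcases a with _ | a <;> rcases b with _ | b
    · simp [U, V, Matrix.mul_apply, blockSign, hw0]; try ring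
    · simp [U, V, Matrix.mul_apply, blockSign, hw1]
    · simp [U, V, Matrix.mul_apply, blockSign, hw0]
    · by_cases hab : a = b
      · subst hab; simp [U, V, Matrix.mul_apply, blockSign, hw1]; try ring
      · simp [U, V, Matrix.mul_apply, blockSign, hw1, hab]
  rw [h1, det_smul_add_mul _ _ _ (by simpa using hκ)]
  have e : Fintype.card (Option κ) - Fintype.card Bool = Fintype.card κ - 1 := by
    simp
  rw [e]
  congr 1
  rw [← Matrix.det_reindex_self finTwoEquiv.symm, Matrix.det_fin_two]
  simp [U, V, Matrix.mul_apply, Fintype.sum_option, finTwoEquiv]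
  ring

/-- The block containing a vertex. -/
def blockOf (m p h : ℕ) : Fin (m * p) ⊕ Fin h → Option (Option (Fin m))
  | .inl i => some (some (finProdFinEquiv.symm i).1)
  | .inr j => if (j : ℕ) < h - p then none else some none

lemma sum_fin_lt (h c : ℕ) (hc : c ≤ h) :
    (∑ j : Fin h, if (j : ℕ) < c then (1 : ℝ) else 0) = c := by
  rw [Fin.sum_univ_eq_sum_range (fun j => if j < c then (1 : ℝ) else 0) h,
    ← Finset.sum_filter]
  have : (Finset.range h).filter (fun j => j < c) = Finset.range c := by
    ext x; simp; omega
  simp [this]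

lemma sum_blockOf (m p h : ℕ) (hph : p ≤ h) (b : Option (Option (Fin m))) :
    (∑ y, if blockOf m p h y = b then (1 : ℝ) else 0)
      = if b = none then (h : ℝ) - p else p := by
  have hc := sum_fin_lt h (h - p) (by omega)
  rw [Nat.cast_sub hph] at hc
  rw [Fintype.sum_sum_type]
  rcases b with _ | _ | q
  · rw [if_pos rfl, ← hc]
    have : ∀ j : Fin h, (if blockOf m p h (.inr j) = none then (1 : ℝ) else 0)
        = if (j : ℕ) < h - p then (1 : ℝ) else 0 := by
      intro j
      by_cases hj : (j : ℕ) < h - p <;> simp [blockOf, hj]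
    simp only [this]
    simp [blockOf]
  · have : ∀ j : Fin h, (if blockOf m p h (.inr j) = some none then (1 : ℝ) else 0)
        = 1 - if (j : ℕ) < h - p then (1 : ℝ) else 0 := by
      intro j
      by_cases hj : (j : ℕ) < h - p <;> simp [blockOf, hj]
    simp only [this, Finset.sum_sub_distrib, hc]
    simp [blockOf]
  · have : ∀ j : Fin h, (if blockOf m p h (.inr j) = some (some q) then (1 : ℝ) else 0) = 0 := by
      intro j
      by_cases hj : (j : ℕ) < h - p <;> simp [blockOf, hj]
    simp only [this]
    rw [← finProdFinEquiv.sum_comp, Fintype.sum_prod_type]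
    simp only [blockOf, Equiv.symm_apply_apply, Option.some.injEq]
    simp

/-- The Seidel matrix, reindexed definitionally with `m = k - 1`. -/
def seidelAux (m p h : ℕ) : Matrix (Fin (m * p) ⊕ Fin h) (Fin (m * p) ⊕ Fin h) ℝ :=
  seidelCliques (m + 1) p h

lemma seidel_eq (m p h : ℕ) (lam : ℝ) :
    seidelAux m p h - lam • (1 : Matrix (Fin (m * p) ⊕ Fin h) (Fin (m * p) ⊕ Fin h) ℝ)
      = (1 - lam) • (1 : Matrix (Fin (m * p) ⊕ Fin h) (Fin (m * p) ⊕ Fin h) ℝ)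
        + (Matrix.of fun x b => if blockOf m p h x = b then (1 : ℝ) else 0)
          * (Matrix.of fun b y => blockSign b (blockOf m p h y)) := by
  ext x y
  simp only [Matrix.sub_apply, Matrix.add_apply, Matrix.smul_apply, Matrix.mul_apply,
    Matrix.of_apply, ite_mul, one_mul, zero_mul, Finset.sum_ite_eq, Finset.mem_univ, if_true]
  rcases x with i | i <;> rcases y with j | j
  · by_cases hij : i = j
    · subst hij; simp [seidelAux, seidelCliques, blockOf, blockSign]; ring
    · have : (finProdFinEquiv.symm i).1 = (finProdFinEquiv.symm j).1
          ↔ (i : ℕ) / p = (j : ℕ) / p := by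
        rw [Fin.ext_iff]; rfl
      simp only [seidelAux, seidelCliques, blockOf, blockSign, Option.some.injEq, this]
      simp [hij]
  · by_cases hj : (j : ℕ) < h - p <;> simp [seidelAux, seidelCliques, blockOf, blockSign, hj]
  · by_cases hj : (i : ℕ) < h - p <;> simp [seidelAux, seidelCliques, blockOf, blockSign, hj]
  · by_cases hij : i = j
    · subst hij
      by_cases hi : (i : ℕ) < h - p <;> (simp [seidelAux, seidelCliques, blockOf, blockSign, hi]; ring)
    · by_cases hi : (i : ℕ) < h - p <;> by_cases hj : (j : ℕ) < h - p <;>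
        simp [seidelAux, seidelCliques, blockOf, blockSign, hi, hj, hij]

/-- Characteristic polynomial of the Seidel matrix of `k` cliques of order `h`
sharing a common `(h−p)`-clique. -/
theorem charpoly_seidelCliques (k p h : ℕ) (hk : 2 ≤ k) (hp : 1 ≤ p) (hph : p ≤ h)
    (hh : 2 ≤ h) (lam : ℝ) :
    (seidelCliques k p h
        - lam • (1 : Matrix (Fin ((k - 1) * p) ⊕ Fin h) (Fin ((k - 1) * p) ⊕ Fin h) ℝ)).det
      = (1 - 2 * (p : ℝ) - lam) ^ (k - 2) * (1 - lam) ^ ((k - 1) * p + h - k - 1) *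
          (-lam ^ 3
            - (2 * (h : ℝ) - (((k : ℝ) - 1) * p + h) + 2 * p - 3) * lam ^ 2
            - (2 * (h : ℝ) ^ 2 - 2 * ((h : ℝ) - 1) * (((k : ℝ) - 1) * p + h)
                + 2 * ((h : ℝ) - 2) * p - 4 * h + 3) * lam
            + 2 * (h : ℝ) ^ 2 - (2 * (h : ℝ) - 1) * (((k : ℝ) - 1) * p + h)
            - 2 * (2 * (h : ℝ) ^ 2 - 2 * h * (((k : ℝ) - 1) * p + h) - h + 1) * p
            + 4 * ((h : ℝ) - (((k : ℝ) - 1) * p + h)) * p ^ 2 - 2 * h + 1) := by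
  obtain ⟨m, rfl⟩ : ∃ m, k = m + 1 := ⟨k - 1, by omega⟩
  have hm : 1 ≤ m := by omega
  have hn : m + 2 ≤ m * p + h := by
    rcases Nat.lt_or_ge p 2 with h2 | h2
    · have : p = 1 := by omega
      subst this; omega
    · nlinarith
  have key := seidel_eq m p h lam
  have step := det_smul_add_mul
    (Matrix.of fun x b => if blockOf m p h x = b then (1 : ℝ) else 0)
    (Matrix.of fun b y => blockSign b (blockOf m p h y)) (1 - lam) (by simp; omega)
  rw [← key] at step
  have hVU : (Matrix.of fun b y => blockSign b (blockOf m p h y))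
      * (Matrix.of fun x b => if blockOf m p h x = b then (1 : ℝ) else 0)
      = Matrix.of (fun a b : Option (Option (Fin m)) =>
          blockSign a b * (if b = none then (h : ℝ) - p else p)) := by
    ext a b
    rw [Matrix.mul_apply, Matrix.of_apply, ← sum_blockOf m p h hph b, Finset.mul_sum]
    refine Finset.sum_congr rfl fun y _ => ?_
    simp only [Matrix.of_apply]
    split_ifs with hy
    · rw [hy]
    · simp
  rw [hVU, det_quotient (by simp) (p : ℝ) ((h : ℝ) - p) (1 - lam) _ (by simp) (by simp)] at step
  refine Eq.trans step ?_
  have e1 : Fintype.card (Fin (m * p) ⊕ Fin h) - Fintype.card (Option (Option (Fin m)))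
      = (m + 1 - 1) * p + h - (m + 1) - 1 := by
    simp; omega
  have e2 : Fintype.card (Option (Fin m)) - 1 = (m + 1 - 2) + 1 := by
    simp; omega
  rw [e1, e2, pow_succ]
  simp only [Fintype.card_option, Fintype.card_fin]
  push_cast
  ring
end

section
/- Let k ≥ 2 and 1 ≤ p ≤ h with h ≥ 2 be integers and set n = (k−1)p + h. Then 1 is an eigenvalue of the Seidel matrix S of the signed complete graph on n vertices whose negative edges induce the union of k cliques of order h sharing a common clique of order h − p, with algebraic multiplicity at least n − k − 1; that is, (λ − 1)^(n−k−1) divides the characteristic polynomial det(λ·I_n − S). -/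
/-- Clique class of a vertex: private classes `0..k-1`, common class `k`. -/
def cliqueClass (k p h : ℕ) (hp : 1 ≤ p) : Fin ((k - 1) * p) ⊕ Fin h → Fin (k + 1)
  | .inl i => ⟨(i : ℕ) / p, by
      have := (Nat.div_lt_iff_lt_mul (by omega : 0 < p)).2 i.2
      omega⟩
  | .inr j => if (j : ℕ) < h - p then ⟨k, by omega⟩ else ⟨k - 1, by omega⟩

/-- Quotient matrix on classes. -/
def classMatrix (k : ℕ) : Matrix (Fin (k + 1)) (Fin (k + 1)) ℝ :=
  Matrix.of fun c d => if c = d ∨ (c : ℕ) = k ∨ (d : ℕ) = k then -1 else 1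

theorem seidel_sub_one (k p h : ℕ) (hk : 2 ≤ k) (hp : 1 ≤ p) :
    seidelCliques k p h - Matrix.scalar _ (1 : ℝ) =
      (Matrix.of fun x c => classMatrix k (cliqueClass k p h hp x) c) *
      (Matrix.of fun c y => if c = cliqueClass k p h hp y then (1 : ℝ) else 0) := by
  ext x y
  simp only [Matrix.mul_apply, Matrix.of_apply, mul_ite, mul_one, mul_zero,
    Finset.sum_ite_eq', Finset.mem_univ, if_true]
  rcases x with i | i <;> rcases y with j | j
  · have hi := (Nat.div_lt_iff_lt_mul (by omega : 0 < p)).2 i.2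
    have hj := (Nat.div_lt_iff_lt_mul (by omega : 0 < p)).2 j.2
    have h1 : (i : ℕ) / p ≠ k := by omega
    have h2 : (j : ℕ) / p ≠ k := by omega
    by_cases hij : i = j
    · subst hij
      simp [seidelCliques, classMatrix, cliqueClass]
    · simp [seidelCliques, classMatrix, cliqueClass, hij, h1, h2]
  · have hi := (Nat.div_lt_iff_lt_mul (by omega : 0 < p)).2 i.2
    have h1 : (i : ℕ) / p ≠ k := by omega
    have h2 : (i : ℕ) / p ≠ k - 1 := by omega
    have h3 : k - 1 ≠ k := by omega
    by_cases hc : (j : ℕ) < h - p <;>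
      simp [seidelCliques, classMatrix, cliqueClass, hc, h1, h2, h3]
  · have hj := (Nat.div_lt_iff_lt_mul (by omega : 0 < p)).2 j.2
    have h1 : (j : ℕ) / p ≠ k := by omega
    have h2 : k - 1 ≠ (j : ℕ) / p := by omega
    have h3 : k - 1 ≠ k := by omega
    by_cases hc : (i : ℕ) < h - p <;>
      simp [seidelCliques, classMatrix, cliqueClass, hc, h1, h2, h3]
  · have h3 : k - 1 ≠ k := by omega
    by_cases hij : i = j
    · subst hij
      simp [seidelCliques, classMatrix]
    · by_cases hc : (i : ℕ) < h - p <;> by_cases hd : (j : ℕ) < h - p <;>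
        simp [seidelCliques, classMatrix, cliqueClass, hij, hc, hd]

/-- `1` is an eigenvalue of the Seidel matrix with algebraic multiplicity at least
`n − k − 1`, i.e. `(X − 1)^(n−k−1)` divides the characteristic polynomial. -/
theorem one_root_charpoly_seidelCliques (k p h : ℕ) (hk : 2 ≤ k) (hp : 1 ≤ p)
    (hph : p ≤ h) (hh : 2 ≤ h) :
    (Polynomial.X - Polynomial.C (1 : ℝ)) ^ ((k - 1) * p + h - k - 1)
      ∣ (seidelCliques k p h).charpoly := by
  rcases Nat.lt_or_ge ((k - 1) * p + h) (k + 1) with hlt | hge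
  · have : (k - 1) * p + h - k - 1 = 0 := by omega
    rw [this, pow_zero]
    exact one_dvd _
  have key := Matrix.charpoly_mul_comm'
      (Matrix.of fun x c => classMatrix k (cliqueClass k p h hp x) c)
      (Matrix.of fun c y => if c = cliqueClass k p h hp y then (1 : ℝ) else 0)
  rw [← seidel_sub_one k p h hk hp] at key
  simp only [Fintype.card_sum, Fintype.card_fin] at key
  have hd : (Polynomial.X : Polynomial ℝ) ^ ((k - 1) * p + h - k - 1) ∣
      (seidelCliques k p h - Matrix.scalar _ (1 : ℝ)).charpoly := by
    have hX : (Polynomial.X : Polynomial ℝ) ^ (k + 1) ≠ 0 := pow_ne_zero _ Polynomial.X_ne_zero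
    rw [← mul_dvd_mul_iff_left hX, ← pow_add, key,
      show k + 1 + ((k - 1) * p + h - k - 1) = (k - 1) * p + h by omega]
    exact dvd_mul_right _ _
  rw [Matrix.charpoly_sub_scalar] at hd
  obtain ⟨q, hq⟩ := hd
  refine ⟨q.comp (Polynomial.X - Polynomial.C 1), ?_⟩
  have := congrArg (fun r => Polynomial.comp r (Polynomial.X - Polynomial.C 1)) hq
  simpa [Polynomial.comp_assoc] using this
end
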